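/- Let H > 0, τ_H = [(3+ν)H/(6H_{f,3}(ν))]^{1/(1+ν)} and μ_H = min{(τ_H−1)/τ_H, τ_H^ν·(τ_H−1)·H_{f,3}(ν)}. If τ_H ≥ 1, then for every x ∈ E the function Ω_{x,3,H}^{(ν)} is μ_H-strongly convex relative to ρ_x: for all u, v ∈ E, Ω_{x,3,H}^{(ν)}(u) ≥ Ω_{x,3,H}^{(ν)}(v) + ⟨∇Ω_{x,3,H}^{(ν)}(v), u − v⟩ + μ_H·β_{ρ_x}(v, u). -/

import Mathlib

open scoped InnerProductSpace

theorem iteratedFDeriv_three_apply {E F : Type*} [NormedAddCommGroup E] [NormedSpace ℝ E]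
    [NormedAddCommGroup F] [NormedSpace ℝ F] (f : E → F) (x a b c : E) :
    iteratedFDeriv ℝ 3 f x ![a, b, c] = fderiv ℝ (fderiv ℝ (fderiv ℝ f)) x a b c := by
  rw [iteratedFDeriv_succ_apply_right, iteratedFDeriv_two_apply]
  rfl

section Symmetry

variable {E : Type*} [NormedAddCommGroup E] [NormedSpace ℝ E] {f : E → ℝ}

theorem ContDiff.fderiv_fderiv_comm (hf : ContDiff ℝ 2 f) (x a b : E) :
    fderiv ℝ (fderiv ℝ f) x a b = fderiv ℝ (fderiv ℝ f) x b a :=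
  (hf.contDiffAt.isSymmSndFDerivAt (by simp)) a b

theorem ContDiff.differentiable_fderiv_fderiv (hf : ContDiff ℝ 3 f) :
    Differentiable ℝ (fderiv ℝ (fderiv ℝ f)) :=
  ((hf.fderiv_right (m := 2) (by norm_num)).fderiv_right (m := 1) (by norm_num)).differentiable
    (by norm_num)

theorem ContDiff.hasFDerivAt_fderiv_fderiv_apply (hf : ContDiff ℝ 3 f) (x b c : E) :
    HasFDerivAt (fun z => fderiv ℝ (fderiv ℝ f) z b c)
      (((fderiv ℝ (fderiv ℝ (fderiv ℝ f)) x).flip b).flip c) x := by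
  have h := (((hf.differentiable_fderiv_fderiv x).hasFDerivAt.clm_apply
    (hasFDerivAt_const b x)).clm_apply (hasFDerivAt_const c x))
  exact h.congr_fderiv (by ext a; simp)

theorem ContDiff.fderiv_three_comm_right (hf : ContDiff ℝ 3 f) (x a b c : E) :
    fderiv ℝ (fderiv ℝ (fderiv ℝ f)) x a b c = fderiv ℝ (fderiv ℝ (fderiv ℝ f)) x a c b := by
  have h := hf.hasFDerivAt_fderiv_fderiv_apply x b c
  simp_rw [(hf.of_le (by norm_num)).fderiv_fderiv_comm _ b c] at h
  simpa using congrArg (fun l : E →L[ℝ] ℝ => l a)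
    (h.unique (hf.hasFDerivAt_fderiv_fderiv_apply x c b))

theorem ContDiff.fderiv_three_comm_left (hf : ContDiff ℝ 3 f) (x a b c : E) :
    fderiv ℝ (fderiv ℝ (fderiv ℝ f)) x a b c = fderiv ℝ (fderiv ℝ (fderiv ℝ f)) x b a c := by
  have h : ContDiff ℝ 2 (fderiv ℝ f) := hf.fderiv_right (by norm_num)
  rw [(h.contDiffAt.isSymmSndFDerivAt (by simp)) a b]

/-- The Hessian of a convex function is positive semidefinite. -/
theorem ConvexOn.fderiv_fderiv_nonneg (hf : ContDiff ℝ 2 f) (hconv : ConvexOn ℝ Set.univ f)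
    (z w : E) : 0 ≤ fderiv ℝ (fderiv ℝ f) z w w := by
  have hline : ∀ t : ℝ, HasDerivAt (fun t : ℝ => z + t • w) w t := fun t => by
    simpa using ((hasDerivAt_id t).smul_const w).const_add z
  have h1 : ∀ t : ℝ, HasDerivAt (fun t : ℝ => f (z + t • w)) (fderiv ℝ f (z + t • w) w) t :=
    fun t => ((hf.differentiable (by norm_num)) _).hasFDerivAt.comp_hasDerivAt t (hline t)
  have h2 : HasDerivAt (fun t : ℝ => fderiv ℝ f (z + t • w) w)
      (fderiv ℝ (fderiv ℝ f) z w w) 0 := by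
    have hd : Differentiable ℝ (fderiv ℝ f) :=
      (hf.fderiv_right (m := 1) (by norm_num)).differentiable (by norm_num)
    have h : HasFDerivAt (fun y => fderiv ℝ f y w) ((fderiv ℝ (fderiv ℝ f) z).flip w)
        (z + (0 : ℝ) • w) := by
      rw [zero_smul, add_zero]
      exact ((hd z).hasFDerivAt.clm_apply (hasFDerivAt_const w z)).congr_fderiv (by ext a; simp)
    exact h.comp_hasDerivAt 0 (hline 0)
  have hc : ConvexOn ℝ Set.univ (fun t : ℝ => f (z + t • w)) := by
    refine ⟨convex_univ, fun s _ t _ a b ha hb hab => ?_⟩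
    have h := hconv.2 (Set.mem_univ (z + s • w)) (Set.mem_univ (z + t • w)) ha hb hab
    have e : z + (a • s + b • t) • w = a • (z + s • w) + b • (z + t • w) := by
      have : z = (a + b) • z := by rw [hab, one_smul]
      simp only [smul_add, add_smul, smul_smul, smul_eq_mul] at this ⊢
      nth_rewrite 1 [this]
      abel
    simpa only [e] using h
  have hm : Monotone (fun t : ℝ => fderiv ℝ f (z + t • w) w) := by
    have h := hc.monotoneOn_deriv (fun t _ => (h1 t).differentiableAt)
    rw [monotoneOn_univ] at h
    rwa [show deriv (fun t : ℝ => f (z + t • w)) = fun t => fderiv ℝ f (z + t • w) w from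
      funext fun t => (h1 t).deriv] at h
  rw [← h2.deriv]
  exact hm.deriv_nonneg

/-- Second-order expansion bound for the Hessian under a Hölder third derivative. -/
theorem ContDiff.fderiv_fderiv_add_le_of_holder (hf : ContDiff ℝ 3 f) {ν L : ℝ} (hν : 0 ≤ ν)
    (hL : 0 ≤ L) (hHolder : ∀ x y : E,
      ‖iteratedFDeriv ℝ 3 f x - iteratedFDeriv ℝ 3 f y‖ ≤ L * ‖x - y‖ ^ ν) (x s w : E) :
    fderiv ℝ (fderiv ℝ f) (x + s) w w ≤ fderiv ℝ (fderiv ℝ f) x w w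
      + fderiv ℝ (fderiv ℝ (fderiv ℝ f)) x s w w + L * ‖s‖ ^ (1 + ν) * ‖w‖ ^ 2 := by
  have hline : ∀ t : ℝ, HasDerivAt (fun t : ℝ => x + t • s) s t := fun t => by
    simpa using ((hasDerivAt_id t).smul_const s).const_add x
  have h1 : ∀ t : ℝ, HasDerivAt (fun t : ℝ => fderiv ℝ (fderiv ℝ f) (x + t • s) w w)
      (fderiv ℝ (fderiv ℝ (fderiv ℝ f)) (x + t • s) s w w) t := fun t => by
    have h := hf.hasFDerivAt_fderiv_fderiv_apply (x + t • s) w w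
    exact h.comp_hasDerivAt t (hline t)
  obtain ⟨c, ⟨hc0, hc1⟩, hc⟩ := exists_hasDerivAt_eq_slope _ _ (zero_lt_one' ℝ)
    (fun t _ => (h1 t).continuousAt.continuousWithinAt) (fun t _ => h1 t)
  simp only [one_smul, zero_smul, add_zero, sub_zero, div_one] at hc
  have h2 : fderiv ℝ (fderiv ℝ (fderiv ℝ f)) (x + c • s) s w w
      - fderiv ℝ (fderiv ℝ (fderiv ℝ f)) x s w w ≤ L * ‖c • s‖ ^ ν * (‖s‖ * ‖w‖ * ‖w‖) := by
    rw [← iteratedFDeriv_three_apply, ← iteratedFDeriv_three_apply]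
    refine (le_abs_self _).trans ?_
    have h := (iteratedFDeriv ℝ 3 f (x + c • s) - iteratedFDeriv ℝ 3 f x).le_opNorm ![s, w, w]
    simp only [sub_apply, Fin.prod_univ_three, Real.norm_eq_abs] at h
    refine h.trans ?_
    have h' := hHolder (x + c • s) x
    rw [add_sub_cancel_left] at h'
    exact mul_le_mul_of_nonneg_right h' (by positivity)
  have h3 : ‖c • s‖ ^ ν ≤ ‖s‖ ^ ν := by
    refine Real.rpow_le_rpow (norm_nonneg _) ?_ hν
    rw [norm_smul, Real.norm_of_nonneg hc0.le]
    exact mul_le_of_le_one_left (norm_nonneg _) hc1.le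
  have h4 : L * ‖c • s‖ ^ ν * (‖s‖ * ‖w‖ * ‖w‖) ≤ L * ‖s‖ ^ ν * (‖s‖ * ‖w‖ * ‖w‖) := by gcongr
  have h5 : ‖s‖ ^ (1 + ν) = ‖s‖ * ‖s‖ ^ ν := by
    rw [Real.rpow_add' (norm_nonneg _) (by linarith), Real.rpow_one]
  rw [h5]
  linarith [h2, h4]

end Symmetry

theorem exists_hasDerivAt_norm_rpow_mul_inner {E : Type*} [NormedAddCommGroup E]
    [InnerProductSpace ℝ E] {p : ℝ} (hp : 0 < p) (h w : E) (t : ℝ) :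
    ∃ d, ‖h + t • w‖ ^ p * ‖w‖ ^ 2 ≤ d ∧
      HasDerivAt (fun t : ℝ => ‖h + t • w‖ ^ p * ⟪h + t • w, w⟫_ℝ) d t := by
  have hline : HasDerivAt (fun t : ℝ => h + t • w) w t := by
    simpa using ((hasDerivAt_id t).smul_const w).const_add h
  have hin : HasDerivAt (fun t : ℝ => ⟪h + t • w, w⟫_ℝ) (‖w‖ ^ 2) t := by
    simpa [real_inner_self_eq_norm_sq] using hline.inner ℝ (hasDerivAt_const t w)
  have hcont : Continuous (fun t : ℝ => ‖h + t • w‖ ^ p) :=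
    Continuous.rpow_const (by fun_prop) fun _ => Or.inr hp.le
  by_cases hk : h + t • w = 0
  · refine ⟨‖h + t • w‖ ^ p * ‖w‖ ^ 2, le_rfl, ?_⟩
    rw [hasDerivAt_iff_tendsto_slope] at hin ⊢
    refine ((hcont.continuousAt.tendsto.mono_left nhdsWithin_le_nhds).mul hin).congr fun s => ?_
    simp only [slope_def_field, hk, inner_zero_left, mul_zero, sub_zero]
    ring
  · have hn : HasDerivAt (fun t : ℝ => ‖h + t • w‖ ^ p)
        (p * ‖h + t • w‖ ^ (p - 2) * ⟪h + t • w, w⟫_ℝ) t := by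
      have hpos : 0 < ‖h + t • w‖ := norm_pos_iff.2 hk
      have hr := (hline.norm_sq).rpow_const (p := p / 2) (Or.inl (by positivity))
      have e : ∀ y : E, ∀ q : ℝ, (‖y‖ ^ 2) ^ (q / 2) = ‖y‖ ^ q := fun y q => by
        rw [← Real.rpow_natCast, ← Real.rpow_mul (norm_nonneg _)]
        congr 1
        push_cast
        ring
      simp_rw [show p / 2 - 1 = (p - 2) / 2 by ring, e] at hr
      convert hr using 1
      ring
    refine ⟨_, ?_, hn.mul hin⟩
    have : 0 ≤ p * ‖h + t • w‖ ^ (p - 2) * ⟪h + t • w, w⟫_ℝ * ⟪h + t • w, w⟫_ℝ := by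
      rw [mul_assoc]
      exact mul_nonneg (by positivity) (mul_self_nonneg _)
    linarith

/-- A function on the line with nonnegative second derivative lies above its tangent. -/
theorem add_deriv_le_of_hasDerivAt_nonneg {q q' : ℝ → ℝ} (hq : ∀ t, HasDerivAt q (q' t) t)
    (hq' : ∀ t, ∃ d, 0 ≤ d ∧ HasDerivAt q' d t) : q 0 + q' 0 ≤ q 1 := by
  choose d hd hqd using hq'
  have hm := monotone_of_hasDerivAt_nonneg hqd hd
  obtain ⟨c, ⟨hc, -⟩, he⟩ := exists_hasDerivAt_eq_slope q q' (zero_lt_one' ℝ)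
    (fun t _ => (hq t).continuousAt.continuousWithinAt) (fun t _ => hq t)
  have := hm hc.le
  simp at he
  linarith

/-- The cubic model plus a multiple of `‖y - x‖ ^ (3 + ν)` lies above its tangents when the
pointwise second-order lower bound holds. -/
theorem add_fderiv_le_of_cubic_model {E : Type*} [NormedAddCommGroup E] [InnerProductSpace ℝ E]
    {p c α b : ℝ} (hp : 0 < p) (hc : 0 ≤ c) (x : E) (l : E →L[ℝ] ℝ) (A : E →L[ℝ] E →L[ℝ] ℝ)
    (T : E →L[ℝ] E →L[ℝ] E →L[ℝ] ℝ) (hA : ∀ a b, A a b = A b a)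
    (hTl : ∀ a b c, T a b c = T b a c) (hTr : ∀ a b c, T a b c = T a c b)
    (hnonneg : ∀ k w, 0 ≤ α * A w w + T k w w + c * (p + 2) * (‖k‖ ^ p * ‖w‖ ^ 2))
    (Ψ : E → ℝ) (hΨ : ∀ y, Ψ y = b + l (y - x) + α / 2 * A (y - x) (y - x)
      + 1 / 6 * T (y - x) (y - x) (y - x) + c * ‖y - x‖ ^ (p + 2)) (u v : E) :
    Ψ v + fderiv ℝ Ψ v (u - v) ≤ Ψ u := by
  set h := v - x with hh
  set w := u - v with hw
  have hline : ∀ t : ℝ, HasDerivAt (fun t : ℝ => h + t • w) w t := fun t => by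
    simpa using ((hasDerivAt_id t).smul_const w).const_add h
  set q' : ℝ → ℝ := fun t => l w + α * A h w + α * A w w * t
    + 1 / 2 * (T h h w + 2 * T h w w * t + T w w w * t ^ 2)
    + c * (p + 2) * (‖h + t • w‖ ^ p * ⟪h + t • w, w⟫_ℝ) with hq'
  have hΨeq : ∀ t : ℝ, Ψ (v + t • w) = b + l h + l w * t
      + α / 2 * (A h h + 2 * A h w * t + A w w * t ^ 2)
      + 1 / 6 * (T h h h + 3 * T h h w * t + 3 * T h w w * t ^ 2 + T w w w * t ^ 3)
      + c * ‖h + t • w‖ ^ (p + 2) := fun t => by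
    rw [hΨ, show v + t • w - x = h + t • w by rw [hh]; abel]
    simp only [map_add, map_smul, add_apply, smul_apply,
      smul_eq_mul]
    rw [hA w h, hTl w h h, hTr h w h, hTl w h w, hTr w w h, hTl w h w]
    ring
  have hq : ∀ t, HasDerivAt (fun t : ℝ => Ψ (v + t • w)) (q' t) t := fun t => by
    simp_rw [hΨeq]
    have hn := (hasFDerivAt_norm_rpow (h + t • w) (p := p + 2) (by linarith)).comp_hasDerivAt t
      (hline t)
    have hi := hasDerivAt_id' t
    have := (((((hi.const_mul (l w)).const_add (b + l h))).add
      ((((hi.const_mul (2 * A h w)).const_add (A h h)).add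
        ((hi.pow 2).const_mul (A w w))).const_mul (α / 2))).add
      (((((hi.const_mul (3 * T h h w)).const_add (T h h h)).add
        ((hi.pow 2).const_mul (3 * T h w w))).add
          ((hi.pow 3).const_mul (T w w w))).const_mul (1 / 6))).add (hn.const_mul c)
    refine this.congr_deriv ?_
    simp only [hq', smul_apply, innerSL_apply_apply, smul_eq_mul,
      add_sub_cancel_right]
    ring
  have hq2 : ∀ t, ∃ d, 0 ≤ d ∧ HasDerivAt q' d t := fun t => by
    obtain ⟨d, hd, hder⟩ := exists_hasDerivAt_norm_rpow_mul_inner hp h w t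
    have hi := hasDerivAt_id' t
    have := (((hi.const_mul (α * A w w)).const_add (l w + α * A h w)).add
      ((((hi.const_mul (2 * T h w w)).const_add (T h h w)).add
        ((hi.pow 2).const_mul (T w w w))).const_mul (1 / 2))).add (hder.const_mul (c * (p + 2)))
    refine ⟨_, ?_, this⟩
    have h0 := hnonneg (h + t • w) w
    simp only [map_add, map_smul, add_apply, smul_apply,
      smul_eq_mul] at h0
    have h1 : c * (p + 2) * (‖h + t • w‖ ^ p * ‖w‖ ^ 2) ≤ c * (p + 2) * d := by gcongr
    simp
    linarith
  have hdiff : DifferentiableAt ℝ Ψ v := by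
    rw [funext hΨ]
    have : Differentiable ℝ (fun y : E => ‖y - x‖ ^ (p + 2)) :=
      (differentiable_norm_rpow (by linarith)).comp (by fun_prop)
    refine DifferentiableAt.add (by fun_prop) ((this v).const_mul c)
  have hvd : HasDerivAt (fun t : ℝ => Ψ (v + t • w)) (fderiv ℝ Ψ v w) 0 := by
    have hl : HasDerivAt (fun t : ℝ => v + t • w) w 0 := by
      simpa using ((hasDerivAt_id (0 : ℝ)).smul_const w).const_add v
    refine HasFDerivAt.comp_hasDerivAt (0 : ℝ) ?_ hl
    simpa using hdiff.hasFDerivAt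
  have := add_deriv_le_of_hasDerivAt_nonneg hq hq2
  rw [← hvd.unique (hq 0)] at this
  simpa [hw] using this

/-- Theorem 3.3(b). For `H > 0` with `τ_H ≥ 1`, the regularized third-order
Taylor model `Ω_{x,3,H}^{(ν)}` is `μ_H`-strongly convex relative to `ρ_x`. -/
theorem statement_3
    {E : Type*} [NormedAddCommGroup E] [InnerProductSpace ℝ E] [FiniteDimensional ℝ E]
    (ν Hf : ℝ) (hν : ν ∈ Set.Icc (0 : ℝ) 1) (hHf : 0 < Hf)
    (f : E → ℝ) (hf : ContDiff ℝ 3 f) (hconv : ConvexOn ℝ Set.univ f)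
    (hHolder : ∀ x y : E,
      ‖iteratedFDeriv ℝ 3 f x - iteratedFDeriv ℝ 3 f y‖ ≤ Hf * ‖x - y‖ ^ ν)
    (H : ℝ) (hH : 0 < H) (τH μH : ℝ)
    (hτH : τH = ((3 + ν) * H / (6 * Hf)) ^ (1 / (1 + ν)))
    (hμH : μH = min ((τH - 1) / τH) (τH ^ ν * (τH - 1) * Hf))
    (hτH1 : 1 ≤ τH)
    (x : E) (Ω ρ : E → ℝ)
    (hΩ : Ω = fun y => f x + ⟪gradient f x, y - x⟫_ℝ
        + (1 / 2) * iteratedFDeriv ℝ 2 f x ![y - x, y - x]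
        + (1 / 6) * iteratedFDeriv ℝ 3 f x ![y - x, y - x, y - x]
        + (H / 6) * ‖y - x‖ ^ ((3 : ℝ) + ν))
    (hρ : ρ = fun y => (1 / 2) * iteratedFDeriv ℝ 2 f x ![y - x, y - x]
        + (1 / (3 + ν)) * ‖y - x‖ ^ ((3 : ℝ) + ν)) :
    ∀ u v : E, Ω v + ⟪gradient Ω v, u - v⟫_ℝ
      + μH * (ρ u - ρ v - ⟪gradient ρ v, u - v⟫_ℝ) ≤ Ω u := by
  obtain ⟨hν0, hν1⟩ := hν
  have hτ0 : 0 < τH := by linarith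
  have hτν : 0 < τH ^ ν := Real.rpow_pos_of_pos hτ0 ν
  have hτpow : τH ^ (1 + ν) = (3 + ν) * H / (6 * Hf) := by
    rw [hτH, ← Real.rpow_mul (by positivity), one_div_mul_cancel (by linarith), Real.rpow_one]
  have hτpow' : τH ^ (1 + ν) = τH * τH ^ ν := by
    rw [Real.rpow_add hτ0, Real.rpow_one]
  have hHeq : (3 + ν) * H / 6 = τH * τH ^ ν * Hf := by
    rw [← hτpow', hτpow]
    field_simp
  have hμ1 : μH ≤ 1 - 1 / τH := by
    rw [hμH]
    refine (min_le_left _ _).trans_eq ?_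
    field_simp
  have hμ2 : μH ≤ τH ^ ν * (τH - 1) * Hf := hμH ▸ min_le_right _ _
  set A := fderiv ℝ (fderiv ℝ f) x with hA
  set T := fderiv ℝ (fderiv ℝ (fderiv ℝ f)) x with hT
  have hcoef : (H / 6 - μH * (1 / (3 + ν))) * (1 + ν + 2) = τH * τH ^ ν * Hf - μH := by
    rw [← hHeq]
    have : 3 + ν ≠ 0 := by positivity
    field_simp
    ring
  have hdiffN : Differentiable ℝ (fun y : E => ‖y - x‖ ^ ((3 : ℝ) + ν)) :=
    (differentiable_norm_rpow (by linarith)).comp (by fun_prop)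
  simp only [iteratedFDeriv_three_apply, iteratedFDeriv_two_apply, Matrix.cons_val_zero,
    Matrix.cons_val_one, ← hA, ← hT] at hΩ hρ
  have hΩd : Differentiable ℝ Ω := by
    rw [hΩ]
    have : Differentiable ℝ (fun y : E => ⟪gradient f x, y - x⟫_ℝ) :=
      (innerSL ℝ (gradient f x)).differentiable.comp (by fun_prop)
    fun_prop
  have hρd : Differentiable ℝ ρ := by
    rw [hρ]
    fun_prop
  intro u v
  have key := add_fderiv_le_of_cubic_model (p := 1 + ν) (c := H / 6 - μH * (1 / (3 + ν)))
    (α := 1 - μH) (b := f x) (by linarith) ?_ x (innerSL ℝ (gradient f x)) A T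
    ((hf.of_le (by norm_num)).fderiv_fderiv_comm x) (hf.fderiv_three_comm_left x)
    (hf.fderiv_three_comm_right x) ?_ (fun y => Ω y - μH * ρ y) ?_ u v
  · rw [fderiv_fun_sub (hΩd v) ((hρd v).const_mul μH), fderiv_const_mul (hρd v)] at key
    simp only [gradient, InnerProductSpace.toDual_symm_apply]
    simp only [sub_apply, smul_apply, smul_eq_mul] at key
    linarith
  · have : 0 ≤ (H / 6 - μH * (1 / (3 + ν))) * (1 + ν + 2) := by
      rw [hcoef]
      nlinarith [mul_pos hτν hHf]
    exact nonneg_of_mul_nonneg_left this (by linarith)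
  · intro k w
    rw [hcoef]
    have hAw : 0 ≤ A w w := hconv.fderiv_fderiv_nonneg (hf.of_le (by norm_num)) x w
    have h1 := hconv.fderiv_fderiv_nonneg (hf.of_le (by norm_num)) (x + τH • k) w
    have h2 := hf.fderiv_fderiv_add_le_of_holder hν0 hHf.le hHolder x (τH • k) w
    rw [norm_smul, Real.norm_of_nonneg hτ0.le, Real.mul_rpow hτ0.le (norm_nonneg _), hτpow'] at h2
    simp only [map_smul, smul_apply, smul_eq_mul, ← hA, ← hT] at h2
    set N := ‖k‖ ^ (1 + ν) * ‖w‖ ^ 2 with hN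
    have hN0 : 0 ≤ N := by positivity
    have h3 : 0 ≤ 1 / τH * A w w + T k w w + τH ^ ν * Hf * N := by
      have : 0 ≤ 1 / τH * (A w w + τH * T k w w
          + Hf * (τH * τH ^ ν * ‖k‖ ^ (1 + ν)) * ‖w‖ ^ 2) :=
        mul_nonneg (by positivity) (h1.trans h2)
      refine this.trans_eq ?_
      rw [hN]
      field_simp
    have h4 := mul_nonneg (sub_nonneg.2 hμ1) hAw
    have h5 := mul_nonneg (sub_nonneg.2 hμ2) hN0
    linarith
  · intro y
    rw [hΩ, hρ, show (1 + ν + 2 : ℝ) = 3 + ν by ring]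
    simp only [innerSL_apply_apply]
    ring
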